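/- Let R be a finite-dimensional complex solvable Leibniz algebra with nilradical N, and let Q be a subspace with R = N ⊕ Q as vector spaces and dim Q = dim(N/N²). Then every derivation of R is inner: for every linear map d : R → R satisfying d([x,y]) = [d(x),y] + [x,d(y)] for all x,y ∈ R, there exists a ∈ R such that d(x) = [x,a] for all x ∈ R. -/

import Mathlib

open Module Submodule

universe u v w

/-- A bilinear bracket on `L`. -/
abbrev Bil (L : Type u) [AddCommGroup L] [Module ℂ L] : Type u := L →ₗ[ℂ] L →ₗ[ℂ] L

variable {L : Type u} [AddCommGroup L] [Module ℂ L]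

/-- The (right) Leibniz identity. -/
def IsLeibniz (br : Bil L) : Prop :=
  ∀ x y z : L, br (br x y) z = br (br x z) y + br x (br y z)

/-- The span of all brackets `[S, T]`. -/
def bspan (br : Bil L) (S T : Submodule ℂ L) : Submodule ℂ L :=
  Submodule.span ℂ {z : L | ∃ x ∈ S, ∃ y ∈ T, z = br x y}

/-- `I` is a (two-sided) ideal of the subalgebra `S`. -/
def IsIdealIn (br : Bil L) (S I : Submodule ℂ L) : Prop :=
  I ≤ S ∧ ∀ x ∈ I, ∀ y ∈ S, br x y ∈ I ∧ br y x ∈ I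

/-- `I` is a (two-sided) ideal of the whole algebra. -/
abbrev IsIdeal (br : Bil L) (I : Submodule ℂ L) : Prop := IsIdealIn br ⊤ I

/-- Lower central series of the subalgebra `S`. -/
def lcs (br : Bil L) (S : Submodule ℂ L) : ℕ → Submodule ℂ L
  | 0 => S
  | n + 1 => bspan br (lcs br S n) S

/-- The subalgebra `S` is nilpotent. -/
def IsNilpotentSub (br : Bil L) (S : Submodule ℂ L) : Prop :=
  ∃ n, lcs br S n = ⊥

/-- Derived series of the subalgebra `S`. -/
def derS (br : Bil L) (S : Submodule ℂ L) : ℕ → Submodule ℂ L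
  | 0 => S
  | n + 1 => bspan br (derS br S n) (derS br S n)

/-- The subalgebra `S` is solvable. -/
def IsSolvableSub (br : Bil L) (S : Submodule ℂ L) : Prop :=
  ∃ m, derS br S m = ⊥

/-- `N` is the nilradical (maximal nilpotent ideal) of the subalgebra `S`. -/
def IsNilradicalIn (br : Bil L) (S N : Submodule ℂ L) : Prop :=
  IsIdealIn br S N ∧ IsNilpotentSub br N ∧
    ∀ I : Submodule ℂ L, IsIdealIn br S I → IsNilpotentSub br I → I ≤ N

/-- `N` is the nilradical of the whole algebra. -/
abbrev IsNilradical (br : Bil L) (N : Submodule ℂ L) : Prop := IsNilradicalIn br ⊤ N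

/-- `N² = [N, N]`. -/
abbrev sqr (br : Bil L) (N : Submodule ℂ L) : Submodule ℂ L := bspan br N N

/-- `dim (N / N²)`. -/
noncomputable def dimModSq (br : Bil L) (N : Submodule ℂ L) : ℕ :=
  finrank ℂ (↥N ⧸ (Submodule.comap N.subtype (sqr br N)))

/-- The subalgebra `S` splits as a direct sum of two nonzero ideals. -/
def IsSplitIn (br : Bil L) (S : Submodule ℂ L) : Prop :=
  ∃ A B : Submodule ℂ L, IsIdealIn br S A ∧ IsIdealIn br S B ∧
    A ≠ ⊥ ∧ B ≠ ⊥ ∧ A ⊓ B = ⊥ ∧ A ⊔ B = S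

/-- The subalgebra `S` is abelian. -/
def IsAbelianIn (br : Bil L) (S : Submodule ℂ L) : Prop :=
  ∀ x ∈ S, ∀ y ∈ S, br x y = 0

section Two
variable {L1 : Type v} {L2 : Type w} [AddCommGroup L1] [Module ℂ L1]
  [AddCommGroup L2] [Module ℂ L2]

/-- A bracket-preserving linear isomorphism between the subalgebra `S1` of `L1` and
the subalgebra `S2` of `L2`. -/
def SubAlgIso (br1 : Bil L1) (S1 : Submodule ℂ L1) (br2 : Bil L2) (S2 : Submodule ℂ L2) :
    Prop :=
  ∃ φ : S1 →ₗ[ℂ] L2, Function.Injective φ ∧ Set.range ⇑φ = (S2 : Set L2) ∧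
    ∀ x y z : S1, (z : L1) = br1 (x : L1) (y : L1) → φ z = br2 (φ x) (φ y)

/-- An isomorphism of the two algebras. -/
def AlgIso (br1 : Bil L1) (br2 : Bil L2) : Prop :=
  ∃ φ : L1 ≃ₗ[ℂ] L2, ∀ x y : L1, φ (br1 x y) = br2 (φ x) (φ y)

end Two

/-! ### Lie's theorem for anti-representations of a solvable Leibniz algebra -/

/-- Right (anti-)representations. -/
def IsRep (br : Bil L) {V : Type w} [AddCommGroup V] [Module ℂ V]
    (ρ : L →ₗ[ℂ] Module.End ℂ V) : Prop :=
  ∀ a b, ρ (br a b) = ρ b * ρ a - ρ a * ρ b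

section LieSec
attribute [local instance] LieRing.ofAssociativeRing

theorem joint_eigenvector {L : Type u} [AddCommGroup L] [Module ℂ L] (br : Bil L)
    (hsolv : IsSolvableSub br (⊤ : Submodule ℂ L))
    {V : Type w} [AddCommGroup V] [Module ℂ V] [FiniteDimensional ℂ V] [Nontrivial V]
    (ρ : L →ₗ[ℂ] Module.End ℂ V) (hρ : IsRep br ρ) :
    ∃ (χ : L →ₗ[ℂ] ℂ) (v : V), v ≠ 0 ∧ ∀ a, ρ a v = χ a • v := by
  let G : LieSubalgebra ℂ (Module.End ℂ V) :=
    { LinearMap.range ρ with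
      lie_mem' := by
        rintro _ _ ⟨a, rfl⟩ ⟨b, rfl⟩
        refine ⟨br b a, ?_⟩
        rw [hρ, Ring.lie_def] }
  have hG : ∀ x, x ∈ G ↔ ∃ a, ρ a = x := fun x => Iff.rfl
  have key : ∀ n, ∀ x : G, x ∈ LieAlgebra.derivedSeries ℂ G n →
      ∃ a ∈ derS br ⊤ n, ρ a = (x : Module.End ℂ V) := by
    intro n
    induction n with
    | zero =>
      intro x _
      obtain ⟨a, ha⟩ := (hG x).1 x.2
      exact ⟨a, Submodule.mem_top, ha⟩
    | succ n ih =>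
      intro x hx
      rw [LieAlgebra.derivedSeries_def, LieAlgebra.derivedSeriesOfIdeal_succ,
        ← LieAlgebra.derivedSeries_def, ← LieSubmodule.mem_toSubmodule,
        LieSubmodule.lieIdeal_oper_eq_linear_span'] at hx
      induction hx using Submodule.span_induction with
      | mem x hx =>
        obtain ⟨y, hy, z, hz, rfl⟩ := hx
        obtain ⟨a, ha, ha'⟩ := ih y hy
        obtain ⟨b, hb, hb'⟩ := ih z hz
        refine ⟨br b a, Submodule.subset_span ⟨b, hb, a, ha, rfl⟩, ?_⟩
        rw [hρ, LieSubalgebra.coe_bracket, Ring.lie_def, ha', hb']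
      | zero => exact ⟨0, Submodule.zero_mem _, by simp⟩
      | add x y _ _ hx hy =>
        obtain ⟨a, ha, ha'⟩ := hx
        obtain ⟨b, hb, hb'⟩ := hy
        exact ⟨a + b, Submodule.add_mem _ ha hb, by simp [ha', hb']⟩
      | smul c x _ hx =>
        obtain ⟨a, ha, ha'⟩ := hx
        exact ⟨c • a, Submodule.smul_mem _ c ha, by simp [ha']⟩
  have hS : LieAlgebra.IsSolvable G := by
    obtain ⟨m, hm⟩ := hsolv
    refine LieAlgebra.IsSolvable.mk (R := ℂ) (k := m) ?_
    rw [LieSubmodule.eq_bot_iff]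
    intro x hx
    obtain ⟨a, ha, ha'⟩ := key m x hx
    rw [hm, Submodule.mem_bot] at ha
    apply Subtype.ext
    rw [← ha', ha]; simp
  obtain ⟨χ, hχ⟩ := LieModule.exists_nontrivial_weightSpace_of_isSolvable ℂ G V
  obtain ⟨⟨v, hv⟩, hv0⟩ := exists_ne (0 : LieModule.weightSpace V χ)
  rw [LieModule.mem_weightSpace] at hv
  let r : L →ₗ[ℂ] G := LinearMap.codRestrict G.toSubmodule ρ (fun a => ⟨a, rfl⟩)
  refine ⟨χ.comp r, v, by simpa using hv0, fun a => ?_⟩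
  exact hv (r a)

end LieSec

theorem flag_lemma {L : Type u} [AddCommGroup L] [Module ℂ L] (br : Bil L)
    (hsolv : IsSolvableSub br (⊤ : Submodule ℂ L)) (n : ℕ) :
    ∀ {V : Type w} [AddCommGroup V] [Module ℂ V] [FiniteDimensional ℂ V]
    (ρ : L →ₗ[ℂ] Module.End ℂ V) (_ : IsRep br ρ) (_ : finrank ℂ V = n),
    ∃ lam : Fin n → (L →ₗ[ℂ] ℂ),
      (∀ i a, (ρ a).HasEigenvalue (lam i a)) ∧
      (∀ i a b, lam i (br a b) = 0) ∧
      ∃ m : ℕ, ∀ l : List L, (∀ a ∈ l, ∀ i, lam i a = 0) → l.length = m →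
        (l.map ρ).prod = 0 := by
  induction n with
  | zero =>
    intro V _ _ _ ρ hρ hn
    have : Subsingleton V := finrank_zero_iff.1 hn
    refine ⟨fun i => i.elim0, fun i => i.elim0, fun i => i.elim0, 0, fun l _ _ => ?_⟩
    ext v
    exact Subsingleton.elim _ _
  | succ n ih =>
    intro V _ _ _ ρ hρ hn
    have : Nontrivial V := Module.nontrivial_of_finrank_pos (R := ℂ) (by omega)
    obtain ⟨χ, v, hv0, hv⟩ := joint_eigenvector br hsolv ρ hρ
    let W : Submodule ℂ V := ℂ ∙ v
    have hW : ∀ a, W ≤ W.comap (ρ a) := by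
      intro a
      refine (Submodule.span_singleton_le_iff_mem _ _).2 ?_
      change ρ a v ∈ W
      rw [hv]
      exact Submodule.smul_mem _ _ (Submodule.mem_span_singleton_self v)
    let ρ' : L →ₗ[ℂ] Module.End ℂ (V ⧸ W) :=
      { toFun := fun a => W.mapQ W (ρ a) (hW a)
        map_add' := by
          intro a b
          apply Submodule.linearMap_qext
          ext x
          simp
        map_smul' := by
          intro a b
          apply Submodule.linearMap_qext
          ext x
          simp }
    have hρ'a : ∀ a x, ρ' a (W.mkQ x) = W.mkQ (ρ a x) := fun a x => rfl
    have hρ' : IsRep br ρ' := by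
      intro a b
      apply Submodule.linearMap_qext
      ext x
      simp only [LinearMap.comp_apply, LinearMap.sub_apply, Module.End.mul_apply, hρ'a, hρ a b,
        map_sub]
    have hfr : finrank ℂ (V ⧸ W) = n := by
      have h1 := Submodule.finrank_quotient_add_finrank W
      have h2 : finrank ℂ W = 1 := finrank_span_singleton hv0
      omega
    obtain ⟨lam, h1, h2, m, hm⟩ := ih ρ' hρ' hfr
    refine ⟨Fin.cons χ lam, ?_, ?_, m + 1, ?_⟩
    · intro i a
      refine Fin.cases ?_ (fun i => ?_) i
      · exact Module.End.hasEigenvalue_of_hasEigenvector (x := v)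
          (Module.End.hasEigenvector_iff.2 ⟨Module.End.mem_eigenspace_iff.2 (hv a), hv0⟩)
      · rw [Fin.cons_succ]
        have h := h1 i a
        by_contra hcon
        have hinj : Function.Injective (ρ a - algebraMap ℂ (Module.End ℂ V) (lam i a)) := by
          rw [← LinearMap.ker_eq_bot]
          rw [Module.End.HasEigenvalue, Module.End.HasUnifEigenvalue, not_not] at hcon
          rw [← hcon]
          exact (Module.End.eigenspace_def).symm
        have hsur := LinearMap.injective_iff_surjective.1 hinj
        have hsur' : Function.Surjective (ρ' a - algebraMap ℂ (Module.End ℂ (V ⧸ W)) (lam i a)) := by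
          intro y
          obtain ⟨y, rfl⟩ := W.mkQ_surjective y
          obtain ⟨x, rfl⟩ := hsur y
          refine ⟨W.mkQ x, ?_⟩
          simp [Module.algebraMap_end_apply]
          rfl
        have hinj' := LinearMap.injective_iff_surjective.2 hsur'
        apply h
        change Module.End.eigenspace _ _ = _
        rw [Module.End.eigenspace_def]
        exact LinearMap.ker_eq_bot.2 hinj'
    · intro i a b
      refine Fin.cases ?_ (fun i => ?_) i
      · rw [Fin.cons_zero]
        have h := hv (br a b)
        rw [hρ] at h
        simp only [LinearMap.sub_apply, Module.End.mul_apply, hv, map_smul] at h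
        rw [smul_comm, sub_self] at h
        exact (smul_eq_zero.1 h.symm).resolve_right hv0
      · exact h2 i a b
    · intro l hl hlen
      match l with
      | [] => simp at hlen
      | a :: l =>
        have hp : (l.map ρ').prod = 0 := by
          apply hm l
          · intro b hb i
            simpa using hl b (List.mem_cons_of_mem _ hb) i.succ
          · simpa using hlen
        have hq : ∀ (l : List L) x, (l.map ρ').prod (W.mkQ x) = W.mkQ ((l.map ρ).prod x) := by
          intro l
          induction l with
          | nil => intro x; simp
          | cons b l ih => intro x; simp only [List.map_cons, List.prod_cons,
              Module.End.mul_apply, ih, hρ'a]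
        ext x
        have hx := hq l x
        rw [hp, LinearMap.zero_apply] at hx
        have hx' : (l.map ρ).prod x ∈ W := by
          rw [← Submodule.ker_mkQ W]; exact hx.symm
        obtain ⟨c, hc⟩ := Submodule.mem_span_singleton.1 hx'
        have ha : χ a = 0 := by simpa using hl a List.mem_cons_self 0
        simp only [List.map_cons, List.prod_cons, Module.End.mul_apply, ← hc, map_smul, hv, ha]
        simp

/-! ### Generalized eigenspaces -/

theorem lift_genEig {A : Type u} {B : Type v} [AddCommGroup A] [Module ℂ A]
    [FiniteDimensional ℂ A] [AddCommGroup B] [Module ℂ B] [FiniteDimensional ℂ B]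
    (f : A →ₗ[ℂ] B) (hf : Function.Surjective f) (g : Module.End ℂ A) (h : Module.End ℂ B)
    (hfg : ∀ a, f (g a) = h (f a)) (c : ℂ) (b : B) (hb : b ∈ h.maxGenEigenspace c) :
    ∃ a ∈ g.maxGenEigenspace c, f a = b := by
  have hpow : ∀ n a, f (((g - c • (1 : Module.End ℂ A)) ^ n) a)
      = ((h - c • (1 : Module.End ℂ B)) ^ n) (f a) := by
    intro n
    induction n with
    | zero => intro a; simp
    | succ n ih =>
      intro a
      rw [pow_succ, pow_succ, Module.End.mul_apply, Module.End.mul_apply, ih]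
      simp [hfg]
  obtain ⟨n, hn1, hn2⟩ :=
    ((g - c • (1 : Module.End ℂ A)).eventually_isCompl_ker_pow_range_pow.and
      (Filter.eventually_ge_atTop (finrank ℂ B))).exists
  obtain ⟨a0, rfl⟩ := hf b
  have ha0 : a0 ∈ LinearMap.ker ((g - c • (1 : Module.End ℂ A)) ^ n) ⊔
      LinearMap.range ((g - c • (1 : Module.End ℂ A)) ^ n) := by
    rw [hn1.sup_eq_top]; trivial
  obtain ⟨a1, ha1, _, ⟨a2, rfl⟩, rfl⟩ := Submodule.mem_sup.1 ha0
  refine ⟨a1, (Module.End.mem_maxGenEigenspace _ _ _).2 ⟨n, ha1⟩, ?_⟩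
  have h1 : f a1 ∈ h.maxGenEigenspace c := by
    refine (Module.End.mem_maxGenEigenspace _ _ _).2 ⟨n, ?_⟩
    rw [← hpow, LinearMap.mem_ker.1 ha1, map_zero]
  rw [map_add] at hb ⊢
  have h2 := (Submodule.add_mem_iff_right _ h1).1 hb
  rw [hpow] at h2
  have h3 : f a2 ∈ h.maxGenEigenspace c := by
    obtain ⟨k, hk⟩ := (Module.End.mem_maxGenEigenspace _ _ _).1 h2
    refine (Module.End.mem_maxGenEigenspace _ _ _).2 ⟨k + n, ?_⟩
    rw [pow_add, Module.End.mul_apply, hk]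
  rw [Module.End.maxGenEigenspace_eq_genEigenspace_finrank, Module.End.mem_genEigenspace_nat,
    LinearMap.mem_ker] at h3
  obtain ⟨p, rfl⟩ := Nat.exists_eq_add_of_le' hn2
  rw [hpow, pow_add, Module.End.mul_apply, h3]
  simp

theorem br_genEig {L : Type u} [AddCommGroup L] [Module ℂ L] (br : Bil L) (D : Module.End ℂ L)
    (hD : ∀ x y, D (br x y) = br (D x) y + br x (D y)) (a b : ℂ) (x y : L)
    (hx : x ∈ D.maxGenEigenspace a) (hy : y ∈ D.maxGenEigenspace b) :
    br x y ∈ D.maxGenEigenspace (a + b) := by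
  rw [Module.End.mem_maxGenEigenspace] at *
  obtain ⟨i, hi⟩ := hx
  obtain ⟨j, hj⟩ := hy
  have key : ∀ m i j x y, i + j ≤ m → ((D - a • (1 : Module.End ℂ L)) ^ i) x = 0 →
      ((D - b • (1 : Module.End ℂ L)) ^ j) y = 0 →
      ((D - (a + b) • (1 : Module.End ℂ L)) ^ m) (br x y) = 0 := by
    intro m
    induction m with
    | zero =>
      intro i j x y hij hx hy
      obtain ⟨rfl, rfl⟩ : i = 0 ∧ j = 0 := by omega
      simp at hx
      simp [hx]
    | succ m ih =>
      intro i j x y hij hx hy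
      match i, j with
      | 0, j =>
        simp at hx
        simp [hx]
      | i, 0 =>
        simp at hy
        simp [hy]
      | i + 1, j + 1 =>
        rw [pow_succ, Module.End.mul_apply] at *
        have e : (D - (a + b) • (1 : Module.End ℂ L)) (br x y)
            = br ((D - a • (1 : Module.End ℂ L)) x) y
              + br x ((D - b • (1 : Module.End ℂ L)) y) := by
          simp [hD]
          module
        rw [e, map_add, ih i (j + 1) _ _ (by omega) hx (by rw [pow_succ]; exact hy),
          ih (i + 1) j _ _ (by omega) (by rw [pow_succ]; exact hx) hy, add_zero]
  exact ⟨i + j, key _ i j x y le_rfl hi hj⟩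

/-- Sum of the generalized eigenspaces for natural eigenvalues at least `K`. -/
def wtGE (D : Module.End ℂ L) (K : ℕ) : Submodule ℂ L :=
  ⨆ m : {m : ℕ // K ≤ m}, D.maxGenEigenspace ((m : ℕ) : ℂ)

theorem genEig_le_wtGE (D : Module.End ℂ L) {K m : ℕ} (h : K ≤ m) :
    D.maxGenEigenspace (m : ℂ) ≤ wtGE D K :=
  le_iSup (fun m : {m : ℕ // K ≤ m} => D.maxGenEigenspace ((m : ℕ) : ℂ)) ⟨m, h⟩

theorem wtGE_mono (D : Module.End ℂ L) {K m : ℕ} (h : K ≤ m) : wtGE D m ≤ wtGE D K :=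
  iSup_le fun i => genEig_le_wtGE D (h.trans i.2)

theorem br_wtGE (br : Bil L) (D : Module.End ℂ L)
    (hD : ∀ x y, D (br x y) = br (D x) y + br x (D y)) (K M : ℕ) (x y : L)
    (hx : x ∈ wtGE D K) (hy : y ∈ wtGE D M) : br x y ∈ wtGE D (K + M) := by
  unfold wtGE at hx
  induction hx using Submodule.iSup_induction' with
  | mem i x hx =>
    unfold wtGE at hy
    induction hy using Submodule.iSup_induction' with
    | mem j y hy =>
      have := br_genEig br D hD _ _ x y hx hy
      rw [← Nat.cast_add] at this
      exact genEig_le_wtGE D (Nat.add_le_add i.2 j.2) this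
    | zero => simp
    | add y z _ _ hy hz => rw [map_add]; exact Submodule.add_mem _ hy hz
  | zero => simp
  | add x z _ _ hx hz =>
    rw [map_add, LinearMap.add_apply]; exact Submodule.add_mem _ hx hz

/-! ### Lower central series -/

theorem bspan_le {br : Bil L} {S T W : Submodule ℂ L} (h : ∀ x ∈ S, ∀ y ∈ T, br x y ∈ W) :
    bspan br S T ≤ W := by
  refine Submodule.span_le.2 ?_
  rintro _ ⟨x, hx, y, hy, rfl⟩
  exact h x hx y hy

theorem mem_bspan {br : Bil L} {S T : Submodule ℂ L} {x y : L} (hx : x ∈ S) (hy : y ∈ T) :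
    br x y ∈ bspan br S T := Submodule.subset_span ⟨x, hx, y, hy, rfl⟩

theorem lcs_le {br : Bil L} {N : Submodule ℂ L} (hN : ∀ x ∈ N, ∀ y ∈ N, br x y ∈ N) (j : ℕ) :
    lcs br N j ≤ N := by
  induction j with
  | zero => exact le_rfl
  | succ j ih => exact bspan_le fun x hx y hy => hN x (ih hx) y hy

theorem br_lcs_sqr {br : Bil L} (hleib : IsLeibniz br) {N : Submodule ℂ L} (j : ℕ) (x y : L)
    (hx : x ∈ lcs br N j) (hy : y ∈ sqr br N) : br x y ∈ lcs br N (j + 2) := by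
  unfold sqr bspan at hy
  induction hy using Submodule.span_induction with
  | mem y hy =>
    obtain ⟨a, ha, b, hb, rfl⟩ := hy
    have e : br x (br a b) = br (br x a) b - br (br x b) a := by
      rw [hleib x a b]; abel
    rw [e]
    exact Submodule.sub_mem _ (mem_bspan (mem_bspan hx ha) hb) (mem_bspan (mem_bspan hx hb) ha)
  | zero => simp
  | add y z _ _ hy hz => rw [map_add]; exact Submodule.add_mem _ hy hz
  | smul c y _ hy => rw [map_smul]; exact Submodule.smul_mem _ c hy

/-- A subalgebra that generates a nilpotent `N` modulo `N²` contains `N`. -/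
theorem le_of_generates {br : Bil L} (hleib : IsLeibniz br) {N S : Submodule ℂ L}
    (hN : ∀ x ∈ N, ∀ y ∈ N, br x y ∈ N) (hnil : IsNilpotentSub br N)
    (hS : ∀ x ∈ S, ∀ y ∈ S, br x y ∈ S) (hgen : N ≤ S ⊔ sqr br N) : N ≤ S := by
  have hanti : ∀ j, lcs br N (j + 1) ≤ lcs br N j := by
    intro j
    induction j with
    | zero => exact lcs_le hN 1
    | succ j ih => exact bspan_le fun x hx y hy => mem_bspan (ih hx) hy
  have step : ∀ j, lcs br N j ≤ S ⊔ lcs br N (j + 1) := by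
    intro j
    induction j with
    | zero => exact hgen
    | succ j ih =>
      refine bspan_le fun x hx y hy => ?_
      obtain ⟨s, hs, z, hz, rfl⟩ := Submodule.mem_sup.1 (ih hx)
      obtain ⟨t, ht, w, hw, rfl⟩ := Submodule.mem_sup.1 (hgen hy)
      have hs' : s ∈ lcs br N j := (Submodule.add_mem_iff_left _ (hanti j hz)).1 hx
      have e : br (s + z) (t + w) = br s t + (br s w + br z (t + w)) := by
        simp only [map_add, LinearMap.add_apply]; abel
      rw [e]
      exact Submodule.add_mem_sup (hS s hs t ht)
        (Submodule.add_mem _ (br_lcs_sqr hleib j s w hs' hw) (mem_bspan hz hy))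
  have all : ∀ j, N ≤ S ⊔ lcs br N j := by
    intro j
    induction j with
    | zero => exact le_sup_right
    | succ j ih =>
      exact ih.trans (sup_le le_sup_left (step j))
  obtain ⟨n, hn⟩ := hnil
  have := all n
  rwa [hn, sup_bot_eq] at this

/-! ### The nilradical -/

/-- Right multiplication operators. -/
def Rm (br : Bil L) : L →ₗ[ℂ] Module.End ℂ L := br.flip

@[simp]
theorem Rm_apply (br : Bil L) (a x : L) : Rm br a x = br x a := rfl

theorem isRep_flip {br : Bil L} (hleib : IsLeibniz br) :
    IsRep br (Rm br) := by
  intro a b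
  ext x
  simp only [Rm_apply, LinearMap.sub_apply, Module.End.mul_apply]
  rw [hleib x a b]; abel

theorem nilradical_facts {L : Type u} [AddCommGroup L] [Module ℂ L] [FiniteDimensional ℂ L]
    (br : Bil L) (hleib : IsLeibniz br) (hsolv : IsSolvableSub br (⊤ : Submodule ℂ L))
    (N : Submodule ℂ L) (hN : IsNilradical br N) :
    (∀ x y, br x y ∈ N) ∧
      ∀ q, (Rm br q).maxGenEigenspace 0 = ⊤ → q ∈ N := by
  obtain ⟨lam, h1, h2, m, hm⟩ := flag_lemma br hsolv _ (Rm br) (isRep_flip hleib) rfl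
  let M : Submodule ℂ L := ⨅ i, LinearMap.ker (lam i)
  have hM : ∀ a, a ∈ M ↔ ∀ i, lam i a = 0 := by
    intro a; simp [M, Submodule.mem_iInf]
  have hbr : ∀ x y, br x y ∈ M := fun x y => (hM _).2 fun i => h2 i x y
  have key : ∀ i, ∀ x ∈ lcs br M i, ∀ l : List L, (∀ a ∈ l, a ∈ M) → i + l.length = m →
      (l.map (Rm br)).prod x = 0 := by
    intro i
    induction i with
    | zero =>
      intro x _ l hl hlen
      rw [hm l (fun a ha => (hM a).1 (hl a ha)) (by omega)]
      simp
    | succ i ih =>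
      intro x hx l hl hlen
      change x ∈ bspan br _ _ at hx
      unfold bspan at hx
      induction hx using Submodule.span_induction with
      | mem x hx =>
        obtain ⟨y, hy, a, ha, rfl⟩ := hx
        have := ih y hy (l ++ [a]) (by
          intro b hb
          rcases List.mem_append.1 hb with hb | hb
          · exact hl b hb
          · rw [List.mem_singleton.1 hb]; exact ha) (by simp; omega)
        simpa using this
      | zero => simp
      | add y z _ _ hy hz => rw [map_add, hy, hz, add_zero]
      | smul c y _ hy => rw [map_smul, hy, smul_zero]
  have hMN : M ≤ N := by
    refine hN.2.2 M ⟨le_top, fun x _ y _ => ⟨hbr _ _, hbr _ _⟩⟩ ⟨m, ?_⟩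
    rw [Submodule.eq_bot_iff]
    intro x hx
    simpa using key m x hx [] (by simp) (by simp)
  refine ⟨fun x y => hMN (hbr x y), fun q hq => hMN ((hM q).2 fun i => ?_)⟩
  by_contra hne
  obtain ⟨v, hv⟩ := (h1 i q).exists_hasEigenvector
  have hdis := (Module.End.independent_maxGenEigenspace (Rm br q)).pairwiseDisjoint hne
  have hv1 : v ∈ (Rm br q).maxGenEigenspace (lam i q) :=
    Module.End.eigenspace_le_maxGenEigenspace hv.1
  have hv2 : v ∈ (Rm br q).maxGenEigenspace 0 := by rw [hq]; trivial
  exact hv.2 (Submodule.disjoint_def.1 hdis v hv1 hv2)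

/-! ### The action on `N / N²` -/

theorem der_Rm {br : Bil L} (hleib : IsLeibniz br) (q x y : L) :
    Rm br q (br x y) = br (Rm br q x) y + br x (Rm br q y) := hleib x y q

theorem exists_quot_rep (br : Bil L) (hleib : IsLeibniz br) (N : Submodule ℂ L)
    (hall : ∀ x y, br x y ∈ N) :
    ∃ ρ : L →ₗ[ℂ] Module.End ℂ (↥N ⧸ (Submodule.comap N.subtype (sqr br N))),
      IsRep br ρ ∧ ∀ a (x : N), ρ a (Submodule.mkQ _ x) = Submodule.mkQ _ ⟨br x a, hall x a⟩ := by
  let W := Submodule.comap N.subtype (sqr br N)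
  let r : L →ₗ[ℂ] (N →ₗ[ℂ] N) :=
    { toFun := fun a => (Rm br a).restrict (p := N) (q := N) (fun x _ => hall x a)
      map_add' := by intro a b; ext x; simp; rfl
      map_smul' := by intro a b; ext x; simp; rfl }
  have hr : ∀ a x, r a x = ⟨br x a, hall x a⟩ := fun a x => rfl
  have hs : ∀ a, ∀ z ∈ sqr br N, br z a ∈ sqr br N := by
    intro a z hz
    have : sqr br N ≤ (sqr br N).comap (Rm br a) := by
      refine bspan_le fun x hx y hy => ?_
      rw [Submodule.mem_comap, Rm_apply, hleib]
      exact Submodule.add_mem _ (mem_bspan (hall _ _) hy) (mem_bspan hx (hall _ _))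
    exact this hz
  have hW : ∀ a, W ≤ W.comap (r a) := by
    intro a x hx
    exact hs a x hx
  let ρ : L →ₗ[ℂ] Module.End ℂ (N ⧸ W) :=
    { toFun := fun a => W.mapQ W (r a) (hW a)
      map_add' := by
        intro a b
        apply Submodule.linearMap_qext
        ext x
        simp
      map_smul' := by
        intro a b
        apply Submodule.linearMap_qext
        ext x
        simp }
  have hρ : ∀ a (x : N), ρ a (W.mkQ x) = W.mkQ ⟨br x a, hall x a⟩ := fun a x => rfl
  refine ⟨ρ, ?_, hρ⟩
  intro a b
  apply Submodule.linearMap_qext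
  refine LinearMap.ext fun x => ?_
  change ρ _ (W.mkQ x) = ρ b (ρ a (W.mkQ x)) - ρ a (ρ b (W.mkQ x))
  rw [hρ, hρ, hρ, hρ, hρ, ← map_sub]
  congr 1
  apply Subtype.ext
  change br (x : L) (br a b) = br (br x a) b - br (br x b) a
  rw [hleib x a b]; abel

section Main
variable {L : Type u} [AddCommGroup L] [Module ℂ L] [FiniteDimensional ℂ L]
    {br : Bil L} (hleib : IsLeibniz br) {N : Submodule ℂ L}
    (hall : ∀ x y, br x y ∈ N)
    {ρ : L →ₗ[ℂ] Module.End ℂ (↥N ⧸ (Submodule.comap N.subtype (sqr br N)))}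
    (hρ : ∀ a (x : N), ρ a (Submodule.mkQ _ x) = Submodule.mkQ _ ⟨br x a, hall x a⟩)

theorem lift_eig (hall : ∀ x y, br x y ∈ N)
    (hρ : ∀ a (x : N), ρ a (Submodule.mkQ _ x) = Submodule.mkQ _ ⟨br x a, hall x a⟩)
    (q : L) (c : ℂ) (v : ↥N ⧸ (Submodule.comap N.subtype (sqr br N)))
    (hv : v ∈ (ρ q).maxGenEigenspace c) :
    ∃ n : N, (n : L) ∈ (Rm br q).maxGenEigenspace c ∧ Submodule.mkQ _ n = v := by
  obtain ⟨n, hn, hn'⟩ := lift_genEig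
    (Submodule.mkQ (Submodule.comap N.subtype (sqr br N))) (Submodule.mkQ_surjective _)
    ((Rm br q).restrict (p := N) (q := N) (fun x _ => hall x q)) (ρ q)
    (fun a => (hρ q a).symm) c v hv
  refine ⟨n, ?_, hn'⟩
  rw [Module.End.mem_maxGenEigenspace] at hn ⊢
  obtain ⟨k, hk⟩ := hn
  refine ⟨k, ?_⟩
  have : ∀ k (x : N), ((((Rm br q).restrict (p := N) (q := N) (fun x _ => hall x q)
      - c • (1 : Module.End ℂ N)) ^ k) x : L)
      = ((Rm br q - c • (1 : Module.End ℂ L)) ^ k) (x : L) := by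
    intro k
    induction k with
    | zero => intro x; simp
    | succ k ih =>
      intro x
      rw [pow_succ, pow_succ, Module.End.mul_apply, Module.End.mul_apply, ih]
      simp
      rfl
  rw [← this, hk]; rfl

theorem sup_of_mkQ {S : Submodule ℂ L}
    (h : ∀ v : ↥N ⧸ (Submodule.comap N.subtype (sqr br N)),
      ∃ n : N, (n : L) ∈ S ∧ Submodule.mkQ _ n = v) : N ≤ S ⊔ sqr br N := by
  intro x hx
  obtain ⟨n, hn, hn'⟩ := h (Submodule.mkQ _ ⟨x, hx⟩)
  have h1 : (⟨x, hx⟩ - n : N) ∈ Submodule.comap N.subtype (sqr br N) := by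
    rw [← Submodule.ker_mkQ (Submodule.comap N.subtype (sqr br N)), LinearMap.mem_ker, map_sub,
      hn', sub_self]
  have h2 : x - n ∈ sqr br N := h1
  have : x = n + (x - n) := by abel
  rw [this]
  exact Submodule.add_mem_sup hn h2

theorem mem_of_quot_nil (hleib : IsLeibniz br) (hall : ∀ x y, br x y ∈ N)
    (hρ : ∀ a (x : N), ρ a (Submodule.mkQ _ x) = Submodule.mkQ _ ⟨br x a, hall x a⟩)
    (hnil : IsNilpotentSub br N)
    (hrad : ∀ q, (Rm br q).maxGenEigenspace 0 = ⊤ → q ∈ N)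
    (q : L) (hq : (ρ q).maxGenEigenspace 0 = ⊤) : q ∈ N := by
  apply hrad
  have hNle : N ≤ (Rm br q).maxGenEigenspace 0 := by
    refine le_of_generates hleib (fun x _ y _ => hall x y) hnil ?_ ?_
    · intro x hx y hy
      have := br_genEig br (Rm br q) (der_Rm hleib q) 0 0 x y hx hy
      rwa [add_zero] at this
    · refine sup_of_mkQ fun v => ?_
      exact lift_eig hall hρ q 0 v (by rw [hq]; trivial)
  rw [eq_top_iff]
  intro x _
  obtain ⟨k, hk⟩ := (Module.End.mem_maxGenEigenspace _ _ _).1 (hNle (hall x q))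
  refine (Module.End.mem_maxGenEigenspace _ _ _).2 ⟨k + 1, ?_⟩
  rw [pow_succ, Module.End.mul_apply]
  simpa using hk

theorem rho_N (hall : ∀ x y, br x y ∈ N)
    (hρ : ∀ a (x : N), ρ a (Submodule.mkQ _ x) = Submodule.mkQ _ ⟨br x a, hall x a⟩)
    (a : L) (ha : a ∈ N) : ρ a = 0 := by
  apply Submodule.linearMap_qext
  refine LinearMap.ext fun x => ?_
  rw [LinearMap.comp_apply, hρ, LinearMap.comp_apply, LinearMap.zero_apply, ← LinearMap.mem_ker,
    Submodule.ker_mkQ]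
  exact mem_bspan x.2 ha

theorem exists_eigenvalues (hleib : IsLeibniz br) (hsolv : IsSolvableSub br (⊤ : Submodule ℂ L))
    (hall : ∀ x y, br x y ∈ N)
    (hρ : ∀ a (x : N), ρ a (Submodule.mkQ _ x) = Submodule.mkQ _ ⟨br x a, hall x a⟩)
    (hrep : IsRep br ρ)
    (hnil : IsNilpotentSub br N)
    (hrad : ∀ q, (Rm br q).maxGenEigenspace 0 = ⊤ → q ∈ N)
    (hdim : finrank ℂ L = finrank ℂ N + dimModSq br N)
    (c : Fin (dimModSq br N) → ℂ) : ∃ q, ∀ i, (ρ q).HasEigenvalue (c i) := by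
  obtain ⟨lam, h1, h2, m, hm⟩ := flag_lemma br hsolv (dimModSq br N) ρ hrep rfl
  let μ : L →ₗ[ℂ] (Fin (dimModSq br N) → ℂ) := LinearMap.pi lam
  have hker : LinearMap.ker μ ≤ N := by
    intro q hq
    have hq' : ∀ i, lam i q = 0 := fun i => congrFun (LinearMap.mem_ker.1 hq) i
    apply mem_of_quot_nil hleib hall hρ hnil hrad
    have hp := hm (List.replicate m q) (fun a ha i => by rw [List.eq_of_mem_replicate ha, hq'])
      (by simp)
    rw [List.map_replicate, List.prod_replicate] at hp
    rw [eq_top_iff]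
    intro x _
    refine (Module.End.mem_maxGenEigenspace _ _ _).2 ⟨m, ?_⟩
    simp [hp]
  have hsur : Function.Surjective μ := by
    rw [← LinearMap.range_eq_top]
    apply Submodule.eq_top_of_finrank_eq
    apply le_antisymm (Submodule.finrank_le _)
    have e1 := LinearMap.finrank_range_add_finrank_ker μ
    have e2 := Submodule.finrank_mono hker
    rw [Module.finrank_fin_fun]
    omega
  obtain ⟨q, hq⟩ := hsur c
  refine ⟨q, fun i => ?_⟩
  have := h1 i q
  rwa [show lam i q = c i from congrFun hq i] at this

end Main

theorem structure_lemma {L : Type u} [AddCommGroup L] [Module ℂ L] [FiniteDimensional ℂ L]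
    {br : Bil L} (hleib : IsLeibniz br) {N : Submodule ℂ L}
    (hall : ∀ x y, br x y ∈ N)
    {ρ : L →ₗ[ℂ] Module.End ℂ (↥N ⧸ (Submodule.comap N.subtype (sqr br N)))}
    (hρ : ∀ a (x : N), ρ a (Submodule.mkQ _ x) = Submodule.mkQ _ ⟨br x a, hall x a⟩)
    (hnil : IsNilpotentSub br N)
    (hrad : ∀ q, (Rm br q).maxGenEigenspace 0 = ⊤ → q ∈ N)
    (k : ℕ) (hk : dimModSq br N = k) (c : Fin k → ℕ) (hc : Function.Injective c)
    (K : ℕ) (hK : 0 < K) (hc1 : ∀ i, K ≤ c i) (hc2 : ∀ i, c i < K + K)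
    (q : L) (hq : ∀ i, (ρ q).HasEigenvalue (c i : ℂ)) :
    ∃ n : Fin k → L, (∀ i, n i ≠ 0) ∧
      N ≤ Submodule.span ℂ (Set.range n) ⊔ sqr br N ∧
      Disjoint ((Rm br q).maxGenEigenspace 0) N ∧
      (Rm br q).maxGenEigenspace 0 ⊔ N = ⊤ ∧
      (∀ i, n i ∈ (Rm br q).maxGenEigenspace (c i : ℂ)) ∧
      (∀ i, ∀ x ∈ (Rm br q).maxGenEigenspace (c i : ℂ), ∃ a : ℂ, x = a • n i) ∧
      (∀ t, (∀ i, br (n i) t = 0) → t ∈ N) := by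
  set D := Rm br q with hDdef
  have hD : ∀ x y, D (br x y) = br (D x) y + br x (D y) := der_Rm hleib q
  choose v hv using fun i => (hq i).exists_hasEigenvector
  have hli : LinearIndependent ℂ v :=
    Module.End.eigenvectors_linearIndependent' (ρ q) (fun i => (c i : ℂ))
      (fun i j h => hc (Nat.cast_injective (R := ℂ) h)) v hv
  have hspan : Submodule.span ℂ (Set.range v) = ⊤ :=
    hli.span_eq_top_of_card_eq_finrank' (by rw [Fintype.card_fin]; exact hk.symm)
  choose n hn1 hn2 using fun i =>
    lift_eig hall hρ q (c i) (v i) (Module.End.eigenspace_le_maxGenEigenspace (hv i).1)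
  have hn0 : ∀ i, (n i : L) ≠ 0 := by
    intro i h
    apply (hv i).2
    rw [← hn2 i, show n i = 0 from Subtype.ext h, map_zero]
  have hgen : N ≤ Submodule.span ℂ (Set.range fun i => (n i : L)) ⊔ sqr br N := by
    refine sup_of_mkQ fun w => ?_
    have hw : w ∈ Submodule.span ℂ (Set.range v) := by rw [hspan]; trivial
    induction hw using Submodule.span_induction with
    | mem x hx =>
      obtain ⟨i, rfl⟩ := hx
      exact ⟨n i, Submodule.subset_span ⟨i, rfl⟩, hn2 i⟩
    | zero => exact ⟨0, by simp, by simp⟩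
    | add x y _ _ hx hy =>
      obtain ⟨a, ha, ha'⟩ := hx
      obtain ⟨b, hb, hb'⟩ := hy
      exact ⟨a + b, Submodule.add_mem _ ha hb, by rw [map_add, ha', hb']⟩
    | smul r x _ hx =>
      obtain ⟨a, ha, ha'⟩ := hx
      exact ⟨r • a, Submodule.smul_mem _ r ha, by rw [map_smul, ha']⟩
  set S := Submodule.span ℂ (Set.range fun i => (n i : L)) with hS
  have hSK : S ≤ wtGE D K := by
    refine Submodule.span_le.2 ?_
    rintro _ ⟨i, rfl⟩
    exact genEig_le_wtGE D (hc1 i) (hn1 i)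
  have hGK : S ⊔ wtGE D (K + K) ≤ wtGE D K := sup_le hSK (wtGE_mono D (by omega))
  have hNG : N ≤ S ⊔ wtGE D (K + K) := by
    refine le_of_generates hleib (fun x _ y _ => hall x y) hnil ?_ ?_
    · intro x hx y hy
      exact Submodule.mem_sup_right (br_wtGE br D hD K K x y (hGK hx) (hGK hy))
    · exact hgen.trans (sup_le_sup_right le_sup_left _)
  have hind := Module.End.independent_maxGenEigenspace D
  have hwt : ∀ (M : ℕ) (a : ℂ), (∀ m : ℕ, M ≤ m → (m : ℂ) ≠ a) →
      wtGE D M ≤ ⨆ j, ⨆ (_ : j ≠ a), D.maxGenEigenspace j := by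
    intro M a h
    refine iSup_le fun m => ?_
    exact le_iSup₂_of_le (f := fun j (_ : j ≠ a) => D.maxGenEigenspace j) (m : ℂ) (h m m.2) le_rfl
  have hle : ∀ a : ℂ, a ≠ 0 → D.maxGenEigenspace a ≤ N := by
    intro a ha x hx
    obtain ⟨j, hj⟩ := (Module.End.mem_maxGenEigenspace _ _ _).1 hx
    clear hx
    induction j generalizing x with
    | zero => simp at hj; rw [hj]; exact N.zero_mem
    | succ j ih =>
      rw [pow_succ, Module.End.mul_apply] at hj
      have h1 := ih hj
      have h2 : (D - a • (1 : Module.End ℂ L)) x = br x q - a • x := by simp [hDdef]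
      rw [h2, Submodule.sub_mem_iff_right _ (hall x q)] at h1
      exact (Submodule.smul_mem_iff _ ha).1 h1
  refine ⟨fun i => n i, hn0, hgen, ?_, ?_, hn1, ?_, ?_⟩
  · refine (hind 0).mono_right ((hNG.trans hGK).trans (hwt K 0 ?_))
    intro m hm
    have : m ≠ 0 := by omega
    exact_mod_cast this
  · rw [eq_top_iff, ← Module.End.iSup_maxGenEigenspace_eq_top D]
    refine iSup_le fun a => ?_
    by_cases ha : a = 0
    · rw [ha]; exact le_sup_left
    · exact (hle a ha).trans le_sup_right
  · intro i x hx
    have hxN : x ∈ N := by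
      refine hle _ ?_ hx
      have := hc1 i
      have : c i ≠ 0 := by omega
      exact_mod_cast this
    obtain ⟨s, hs, f, hf, hsf⟩ := Submodule.mem_sup.1 (hNG hxN)
    obtain ⟨a, rfl⟩ := (Submodule.mem_span_range_iff_exists_fun ℂ).1 hs
    refine ⟨a i, ?_⟩
    have h1 : x - a i • (n i : L) ∈ D.maxGenEigenspace (c i : ℂ) :=
      Submodule.sub_mem _ hx (Submodule.smul_mem _ _ (hn1 i))
    have h2 : x - a i • (n i : L) ∈ ⨆ j, ⨆ (_ : j ≠ (c i : ℂ)), D.maxGenEigenspace j := by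
      rw [← hsf, ← Finset.add_sum_erase _ _ (Finset.mem_univ i), add_assoc, add_sub_cancel_left]
      refine Submodule.add_mem _ (Submodule.sum_mem _ fun j hj => Submodule.smul_mem _ _ ?_)
        (hwt _ _ ?_ hf)
      · have hne : (c j : ℂ) ≠ (c i : ℂ) := by
          have : c j ≠ c i := fun h => (Finset.mem_erase.1 hj).1 (hc h)
          exact_mod_cast this
        exact (le_iSup₂_of_le (f := fun j (_ : j ≠ (c i : ℂ)) => D.maxGenEigenspace j)
          (c j : ℂ) hne le_rfl) (hn1 j)
      · intro m hm
        have := hc2 i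
        have : m ≠ c i := by omega
        exact_mod_cast this
    exact sub_eq_zero.1 (Submodule.disjoint_def.1 (hind (c i : ℂ)) _ h1 h2)
  · intro t ht
    have h0 : ρ t = 0 := by
      apply LinearMap.ext_on_range hspan
      intro i
      rw [← hn2 i, hρ, show (⟨br (n i) t, hall _ _⟩ : N) = 0 from Subtype.ext (ht i)]
      simp
    apply mem_of_quot_nil hleib hall hρ hnil hrad
    rw [eq_top_iff]
    intro x _
    refine (Module.End.mem_maxGenEigenspace _ _ _).2 ⟨1, ?_⟩
    simp [h0]

/-- Theorem 6.5. Every derivation of a solvable Leibniz algebra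
`R = N ⊕ Q` with nilradical `N` and `dim Q = dim (N/N²)` is inner, i.e. is a right
multiplication operator `x ↦ [x, a]`. -/
theorem stmt11 {L : Type u} [AddCommGroup L] [Module ℂ L] [FiniteDimensional ℂ L]
    (br : Bil L) (hleib : IsLeibniz br) (hsolv : IsSolvableSub br (⊤ : Submodule ℂ L))
    (N Q : Submodule ℂ L) (hN : IsNilradical br N) (hQ : IsCompl N Q)
    (hdimQ : finrank ℂ Q = dimModSq br N) :
    ∀ d : L →ₗ[ℂ] L, (∀ x y : L, d (br x y) = br (d x) y + br x (d y)) →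
      ∃ a : L, ∀ x : L, d x = br x a := by
  intro d hd
  obtain ⟨hall, hrad⟩ := nilradical_facts br hleib hsolv N hN
  have hnil := hN.2.1
  obtain ⟨ρ, hrep, hρ⟩ := exists_quot_rep br hleib N hall
  have hdim : finrank ℂ L = finrank ℂ N + dimModSq br N := by
    rw [← hdimQ, Submodule.finrank_add_eq_of_isCompl hQ]
  obtain ⟨k, hk⟩ : ∃ k, dimModSq br N = k := ⟨_, rfl⟩
  let c : Fin k → ℕ := fun i => k + 1 + i
  have hc : Function.Injective c := by
    intro i j h
    apply Fin.ext
    simp only [c] at h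
    omega
  have hc1 : ∀ i, k + 1 ≤ c i := fun i => by simp only [c]; omega
  have hc2 : ∀ i, c i < (k + 1) + (k + 1) := fun i => by simp only [c]; omega
  have hstr := structure_lemma hleib hall hρ hnil hrad k hk c hc (k + 1) (by omega) hc1 hc2
  -- a suitable element, first without `[q, q] = 0`
  obtain ⟨q, hq⟩ : ∃ q, ∀ i, (ρ q).HasEigenvalue (c i : ℂ) := by
    obtain ⟨q, hq⟩ := exists_eigenvalues hleib hsolv hall hρ hrep hnil hrad hdim
      (fun i => (c (Fin.cast hk i) : ℂ))
    exact ⟨q, fun i => hq (Fin.cast hk.symm i)⟩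
  obtain ⟨p, hp, hpp⟩ : ∃ p, (∀ i, (ρ p).HasEigenvalue (c i : ℂ)) ∧ br p p = 0 := by
    obtain ⟨n, -, -, hdis, hsup, -⟩ := hstr q hq
    have hqt : q ∈ (Rm br q).maxGenEigenspace 0 ⊔ N := by rw [hsup]; trivial
    obtain ⟨p, hp, z, hz, hpz⟩ := Submodule.mem_sup.1 hqt
    refine ⟨p, ?_, ?_⟩
    · have : ρ q = ρ p := by rw [← hpz, map_add, rho_N hall hρ z hz, add_zero]
      rw [← this]; exact hq
    · have h1 := br_genEig br (Rm br q) (der_Rm hleib q) 0 0 p p hp hp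
      rw [add_zero] at h1
      exact Submodule.disjoint_def.1 hdis _ h1 (hall _ _)
  obtain ⟨n, hn0, hgen, hdis, hsup, hn1, hone, hzero⟩ := hstr p hp
  set D := Rm br p with hDdef
  set T := D.maxGenEigenspace 0 with hT
  have hTT : ∀ s ∈ T, ∀ t ∈ T, br s t = 0 := by
    intro s hs t ht
    have h1 := br_genEig br D (der_Rm hleib p) 0 0 s t hs ht
    rw [add_zero] at h1
    exact Submodule.disjoint_def.1 hdis _ h1 (hall _ _)
  have hpT : p ∈ T := (Module.End.mem_maxGenEigenspace _ _ _).2 ⟨1, by simp [hDdef, hpp]⟩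
  -- right multiplications by `T` commute with `D`
  have hcomm : ∀ t ∈ T, Commute D (Rm br t) := by
    intro t ht
    refine LinearMap.ext fun x => ?_
    simp only [Module.End.mul_apply, hDdef, Rm_apply]
    rw [hleib x t p, hTT t ht p hpT, map_zero, add_zero]
  -- `D` is surjective on `N`
  have hsurj : ∀ z ∈ N, ∃ m ∈ N, br m p = z := by
    have hinj : Function.Injective (D.restrict (p := N) (q := N) (fun x _ => hall x p)) := by
      rw [← LinearMap.ker_eq_bot, LinearMap.ker_eq_bot']
      intro x hx
      have hx' : br (x : L) p = 0 := congrArg Subtype.val hx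
      apply Subtype.ext
      refine Submodule.disjoint_def.1 hdis _ ?_ x.2
      exact (Module.End.mem_maxGenEigenspace _ _ _).2 ⟨1, by simp [hDdef, hx']⟩
    intro z hz
    obtain ⟨m, hm⟩ := LinearMap.injective_iff_surjective.1 hinj ⟨z, hz⟩
    exact ⟨m, m.2, congrArg Subtype.val hm⟩
  have hdp : d p ∈ T ⊔ N := by rw [hsup]; trivial
  obtain ⟨s, hs, z, hz, hsz⟩ := Submodule.mem_sup.1 hdp
  obtain ⟨m, hm, hmz⟩ := hsurj z hz
  let d1 : L →ₗ[ℂ] L := d + Rm br m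
  have hd1a : ∀ x, d1 x = d x + br x m := fun x => rfl
  have hd1 : ∀ x y, d1 (br x y) = br (d1 x) y + br x (d1 y) := by
    intro x y
    simp only [hd1a, hd, hleib x y m, map_add, LinearMap.add_apply]
    abel
  have hd1p : ∀ x, d1 (br x p) = br (d1 x) p + br x s := by
    intro x
    have h1 : br (br x m) p = br (br x p) m + br x z := by rw [hleib x m p, hmz]
    simp only [hd1a, hd, ← hsz, map_add, LinearMap.add_apply, h1]
    abel
  -- `d1` preserves the generalized eigenspaces of `D`
  have hpres : ∀ a : ℂ, ∀ x ∈ D.maxGenEigenspace a, d1 x ∈ D.maxGenEigenspace a := by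
    intro a
    have key : ∀ j x, ((D - a • (1 : Module.End ℂ L)) ^ j) x = 0 →
        ((D - a • (1 : Module.End ℂ L)) ^ (j + 1)) (d1 x) = 0 := by
      intro j
      induction j with
      | zero => intro x hx; simp at hx; simp [hx]
      | succ j ih =>
        intro x hx
        have e : (D - a • (1 : Module.End ℂ L)) (d1 x)
            = d1 ((D - a • (1 : Module.End ℂ L)) x) - Rm br s x := by
          simp [hDdef, hd1p]
          abel
        have hc' : Commute ((D - a • (1 : Module.End ℂ L)) ^ (j + 1)) (Rm br s) :=
          (((hcomm s hs).sub_left ((Commute.one_left _).smul_left a))).pow_left _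
        have h2 : ((D - a • (1 : Module.End ℂ L)) ^ (j + 1)) (Rm br s x) = 0 := by
          rw [← Module.End.mul_apply, hc'.eq, Module.End.mul_apply, hx, map_zero]
        rw [pow_succ, Module.End.mul_apply, e, map_sub, h2, sub_zero]
        apply ih
        rwa [pow_succ, Module.End.mul_apply] at hx
    intro x hx
    obtain ⟨j, hj⟩ := (Module.End.mem_maxGenEigenspace _ _ _).1 hx
    exact (Module.End.mem_maxGenEigenspace _ _ _).2 ⟨j + 1, key j x hj⟩
  have hnt : ∀ i, ∀ t ∈ T, ∃ a : ℂ, br (n i) t = a • n i := by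
    intro i t ht
    exact hone i _ (Module.End.mapsTo_maxGenEigenspace_of_comm (hcomm t ht) _ (hn1 i))
  choose γ hγ using fun i => hone i _ (hpres _ _ (hn1 i))
  have hTz : ∀ t ∈ T, t ∈ N → t = 0 := fun t h1 h2 => Submodule.disjoint_def.1 hdis t h1 h2
  have hd1T : ∀ t ∈ T, d1 t = 0 := by
    intro t ht
    refine hTz _ (hpres 0 t ht) (hzero _ fun i => ?_)
    obtain ⟨a, ha⟩ := hnt i t ht
    have h1 := hd1 (n i) t
    rw [ha, map_smul, hγ i, map_smul, LinearMap.smul_apply, ha, smul_comm] at h1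
    simpa using h1
  -- find `t` with prescribed eigenvalues
  choose g hg using fun i => Module.Projective.exists_dual_eq_one ℂ (hn0 i)
  have hga : ∀ i, ∀ t ∈ T, br (n i) t = g i (br (n i) t) • n i := by
    intro i t ht
    obtain ⟨a, ha⟩ := hnt i t ht
    rw [ha, map_smul, hg, smul_eq_mul, mul_one]
  let Φ : T →ₗ[ℂ] (Fin k → ℂ) := LinearMap.pi fun i => (g i).comp ((br (n i)).comp T.subtype)
  have hΦ : ∀ t i, Φ t i = g i (br (n i) t) := fun t i => rfl
  have hΦinj : Function.Injective Φ := by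
    rw [← LinearMap.ker_eq_bot, LinearMap.ker_eq_bot']
    intro t ht
    apply Subtype.ext
    refine hTz _ t.2 (hzero _ fun i => ?_)
    rw [hga i t t.2, ← hΦ, ht]
    simp
  have hfT : finrank ℂ T = finrank ℂ (Fin k → ℂ) := by
    have := Submodule.finrank_add_eq_of_isCompl ⟨hdis, codisjoint_iff.2 hsup⟩
    rw [Module.finrank_fin_fun]
    omega
  obtain ⟨t, ht⟩ := (LinearMap.injective_iff_surjective_of_finrank_eq_finrank hfT).1 hΦinj γ
  have htn : ∀ i, br (n i) t = γ i • n i := by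
    intro i
    rw [hga i t t.2, ← hΦ, ht]
  let d2 : L →ₗ[ℂ] L := d1 - Rm br t
  have hd2a : ∀ x, d2 x = d1 x - br x t := fun x => rfl
  have hd2 : ∀ x y, d2 (br x y) = br (d2 x) y + br x (d2 y) := by
    intro x y
    simp only [hd2a, hd1, hleib x y t, map_sub, LinearMap.sub_apply]
    abel
  have hNker : N ≤ LinearMap.ker d2 := by
    refine le_of_generates hleib (fun x _ y _ => hall x y) hnil ?_
      (hgen.trans (sup_le_sup_right ?_ _))
    · intro x hx y hy
      rw [LinearMap.mem_ker] at *
      rw [hd2, hx, hy]; simp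
    · refine Submodule.span_le.2 ?_
      rintro _ ⟨i, rfl⟩
      change d2 (n i) = 0
      rw [hd2a, hγ, htn, sub_self]
  have hker : LinearMap.ker d2 = ⊤ := by
    rw [eq_top_iff, ← hsup]
    refine sup_le ?_ hNker
    intro x hx
    rw [LinearMap.mem_ker, hd2a, hd1T x hx, hTT x hx t t.2, sub_zero]
  refine ⟨t - m, fun x => ?_⟩
  have hx : d2 x = 0 := by
    rw [← LinearMap.mem_ker, hker]; trivial
  rw [hd2a, hd1a] at hx
  rw [map_sub]
  rw [sub_eq_zero] at hx
  rw [← hx]; abel
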